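/- Let m ≥ 2, let α_1, …, α_m be a trellis in ℝ^{m−1}, let s_1, …, s_m be positive integers with gcd(s_1,…,s_m) = 1, set ŝ = s_1 + ⋯ + s_m and β = (1/ŝ)·∑_{i=1}^m s_i·α_i. Then every finite (𝒜,β)-mediated set B ⊆ ℝ^{m−1} satisfies |B| ≥ ⌈log₂ ŝ⌉. -/

import Mathlib

/-- `B` is an `A`-mediated set: every point of `B` is the average of two
distinct points of `A ∪ B`. -/
def IsMediatedSet {d : ℕ} (A : Set (Fin d → ℝ)) (B : Finset (Fin d → ℝ)) : Prop :=
  ∀ β ∈ B, ∃ γ ∈ A ∪ ↑B, ∃ δ ∈ A ∪ ↑B, γ ≠ δ ∧ (2 : ℝ) • β = γ + δ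

namespace Matrix

/-- The case of `Fin n` of `Matrix.det_nonneg_and_le_prod_diag`. -/
theorem det_nonneg_and_le_prod_diag_fin :
    ∀ (n : ℕ) (P : Matrix (Fin n) (Fin n) ℝ), (∀ i j, i ≠ j → P i j ≤ 0) →
      (∀ i, 0 ≤ ∑ j, P i j) → 0 ≤ P.det ∧ P.det ≤ ∏ i, P i i
  | 0, P, _, _ => by simp
  | n + 1, P, hoff, hsum => by
    have hdiag : 0 ≤ P 0 0 := by
      have h := hsum 0
      rw [Fin.sum_univ_succ] at h
      have : ∑ j : Fin n, P 0 j.succ ≤ 0 :=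
        Finset.sum_nonpos fun j _ => hoff _ _ (Fin.succ_ne_zero j).symm
      linarith
    rcases hdiag.eq_or_lt with h0 | hpos
    · have hrow : ∀ j, P 0 j = 0 := by
        have hle : ∀ j ∈ Finset.univ, P 0 j ≤ 0 := fun j _ => by
          by_cases hj : j = 0
          · rw [hj, ← h0]
          · exact hoff _ _ (Ne.symm hj)
        have hz := (Finset.sum_eq_zero_iff_of_nonpos hle).1
          (le_antisymm (Finset.sum_nonpos hle) (hsum 0))
        exact fun j => hz j (Finset.mem_univ j)
      rw [det_eq_zero_of_row_eq_zero 0 hrow, Fin.prod_univ_succ, ← h0]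
      simp
    · let S : Matrix (Fin n) (Fin n) ℝ :=
        fun i j => P i.succ j.succ - P i.succ 0 / P 0 0 * P 0 j.succ
      have hcoef : ∀ i : Fin n, P i.succ 0 / P 0 0 ≤ 0 := fun i =>
        div_nonpos_of_nonpos_of_nonneg (hoff _ _ (Fin.succ_ne_zero i)) hdiag
      have hSle : ∀ i j, S i j ≤ P i.succ j.succ := fun i j =>
        sub_le_self _ (mul_nonneg_of_nonpos_of_nonpos (hcoef i)
          (hoff _ _ (Fin.succ_ne_zero j).symm))
      have hSsum : ∀ i, 0 ≤ ∑ j, S i j := fun i => by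
        have h1 := hsum i.succ
        have h2 := hsum 0
        rw [Fin.sum_univ_succ] at h1 h2
        have h3 : P i.succ 0 / P 0 0 * P 0 0 = P i.succ 0 := div_mul_cancel₀ _ hpos.ne'
        have h4 := mul_nonneg_of_nonpos_of_nonpos (hcoef i) (neg_nonpos.2 h2)
        simp only [S, Finset.sum_sub_distrib, ← Finset.mul_sum]
        nlinarith
      obtain ⟨ih0, ih1⟩ := det_nonneg_and_le_prod_diag_fin n S
        (fun i j hij => (hSle i j).trans (hoff _ _ fun h => hij (Fin.succ_injective _ h))) hSsum
      have hdet : P.det = P 0 0 * S.det := by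
        let Q : Matrix (Fin (n + 1)) (Fin (n + 1)) ℝ :=
          fun i j => P i j - (if i = 0 then 0 else P i 0 / P 0 0) * P 0 j
        have hPQ : P.det = Q.det :=
          det_eq_of_forall_row_eq_smul_add_const
            (fun i => if i = 0 then 0 else P i 0 / P 0 0) 0 (by simp)
            (fun i j => by simp [Q])
        rw [hPQ, det_succ_column_zero, Fin.sum_univ_succ, Finset.sum_eq_zero]
        · have : Q.submatrix (Fin.succAbove 0) Fin.succ = S := by
            ext i j
            rw [submatrix_apply, Fin.succAbove_zero]
            simp [Q, S]
          rw [this]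
          simp [Q]
        · intro i _
          have : Q i.succ 0 = 0 := by simp [Q, hpos.ne']
          rw [this]
          simp
      rw [hdet, Fin.prod_univ_succ]
      refine ⟨mul_nonneg hdiag ih0, mul_le_mul_of_nonneg_left (ih1.trans ?_) hdiag⟩
      refine Finset.prod_le_prod (fun i _ => ?_) fun i _ => hSle i i
      have h := hSsum i
      rw [← Finset.add_sum_erase _ _ (Finset.mem_univ i)] at h
      have : ∑ j ∈ Finset.univ.erase i, S i j ≤ 0 :=
        Finset.sum_nonpos fun j hj => (hSle i j).trans
          (hoff _ _ fun h => Finset.ne_of_mem_erase hj (Fin.succ_injective _ h).symm)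
      linarith

/-- A real square matrix with nonpositive off-diagonal entries and nonnegative row sums has
a nonnegative determinant, bounded above by the product of its diagonal entries. -/
theorem det_nonneg_and_le_prod_diag {ι : Type*} [Fintype ι] [DecidableEq ι] (P : Matrix ι ι ℝ)
    (hoff : ∀ i j, i ≠ j → P i j ≤ 0) (hsum : ∀ i, 0 ≤ ∑ j, P i j) :
    0 ≤ P.det ∧ P.det ≤ ∏ i, P i i := by
  let e := (Fintype.equivFin ι).symm
  have h := det_nonneg_and_le_prod_diag_fin _ (P.submatrix e e)
    (fun i j hij => hoff _ _ (e.injective.ne hij))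
    (fun i => by
      have := hsum (e i)
      rwa [← e.sum_comp] at this)
  rw [det_submatrix_equiv_self] at h
  simpa only [submatrix_apply, e.prod_comp fun i => P i i] using h

end Matrix

/-- No nonempty finite set of points has all its points being midpoints of two distinct points
of the set. -/
theorem exists_not_midpoint {d : ℕ} (F : Finset (Fin d → ℝ)) (hF : F.Nonempty) :
    ∃ b ∈ F, ∀ γ ∈ F, ∀ δ ∈ F, (2 : ℝ) • b = γ + δ → γ = δ := by
  obtain ⟨b, hb, hmax⟩ := F.exists_max_image (fun x => x ⬝ᵥ x) hF
  refine ⟨b, hb, fun γ hγ δ hδ h => ?_⟩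
  have h1 := hmax γ hγ
  have h2 := hmax δ hδ
  have h3 : ((2 : ℝ) • b) ⬝ᵥ ((2 : ℝ) • b) = (γ + δ) ⬝ᵥ (γ + δ) := by rw [h]
  have h4 : (γ - δ) ⬝ᵥ (γ - δ) ≤ 0 := by
    simp only [smul_dotProduct, dotProduct_smul, add_dotProduct, dotProduct_add, sub_dotProduct,
      dotProduct_sub, smul_eq_mul, dotProduct_comm δ γ] at h3 ⊢
    linarith
  have h5 : 0 ≤ (γ - δ) ⬝ᵥ (γ - δ) := Finset.sum_nonneg fun i _ => mul_self_nonneg _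
  exact sub_eq_zero.1 (dotProduct_self_eq_zero.1 (le_antisymm h4 h5))

/-- A function vanishing off `B` whose value at every point of `B` is the mean of its values at
two distinct points having that point as midpoint is nonpositive. -/
theorem nonpos_of_midpoint_mean {d : ℕ} (B : Finset (Fin d → ℝ))
    (γ δ : (Fin d → ℝ) → (Fin d → ℝ)) (hne : ∀ b ∈ B, γ b ≠ δ b)
    (hmid : ∀ b ∈ B, (2 : ℝ) • b = γ b + δ b) (w : (Fin d → ℝ) → ℝ)
    (hw0 : ∀ x, x ∉ B → w x = 0) (hw : ∀ b ∈ B, 2 * w b = w (γ b) + w (δ b)) (x : Fin d → ℝ) :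
    w x ≤ 0 := by
  by_contra! hx
  have hxB : x ∈ B := by_contra fun h => hx.ne' (hw0 x h)
  obtain ⟨c, hc, hmax⟩ := B.exists_max_image w ⟨x, hxB⟩
  have hcpos : 0 < w c := hx.trans_le (hmax x hxB)
  have hle : ∀ y, w y ≤ w c := fun y => by
    by_cases hy : y ∈ B
    · exact hmax y hy
    · rw [hw0 y hy]
      exact hcpos.le
  have hmem : ∀ y, w y = w c → y ∈ B.filter fun y => w y = w c := fun y hy =>
    Finset.mem_filter.2 ⟨by_contra fun h => hcpos.ne' (hy ▸ hw0 y h), hy⟩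
  obtain ⟨b, hb, hext⟩ := exists_not_midpoint (B.filter fun y => w y = w c) ⟨c, hmem c rfl⟩
  obtain ⟨hbB, hbc⟩ := Finset.mem_filter.1 hb
  have h := hw b hbB
  have h1 := hle (γ b)
  have h2 := hle (δ b)
  exact hne b hbB (hext _ (hmem _ (by linarith)) _ (hmem _ (by linarith)) (hmid b hbB))

/-- The integer matrix of the linear system `2 b = γ b + δ b`, `b ∈ B`. -/
def midpointMatrix {X : Type*} [DecidableEq X] (B : Finset X) (γ δ : X → X) : Matrix B B ℤ :=
  fun b c => (if b = c then 2 else 0) - (if γ b = c then 1 else 0) - (if δ b = c then 1 else 0)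

section midpointMatrix

variable {X : Type*} [DecidableEq X] (B : Finset X) (γ δ : X → X)

theorem sum_ite_eq_coe (y : X) (v : X → ℝ) :
    ∑ c : B, (if y = c then (1 : ℝ) else 0) * v c = if y ∈ B then v y else 0 := by
  rw [Finset.sum_coe_sort B fun c => (if y = c then (1 : ℝ) else 0) * v c]
  simp

theorem midpointMatrix_mulVec (v : X → ℝ) (b : B) :
    ((midpointMatrix B γ δ).map (Int.cast : ℤ → ℝ)).mulVec (fun c => v c) b =
      2 * v b - (if γ b ∈ B then v (γ b) else 0) - (if δ b ∈ B then v (δ b) else 0) := by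
  rw [← sum_ite_eq_coe, ← sum_ite_eq_coe]
  have h : ∑ c : B, (if b = c then (2 : ℝ) else 0) * v c = 2 * v b := by simp
  rw [← h, ← Finset.sum_sub_distrib, ← Finset.sum_sub_distrib]
  refine Finset.sum_congr rfl fun c _ => ?_
  simp only [midpointMatrix, Matrix.map_apply]
  push_cast
  ring

theorem det_midpointMatrix_nonneg_and_le :
    0 ≤ (midpointMatrix B γ δ).det ∧ (midpointMatrix B γ δ).det ≤ 2 ^ B.card := by
  have h := Matrix.det_nonneg_and_le_prod_diag ((midpointMatrix B γ δ).map (Int.cast : ℤ → ℝ))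
    (fun i j hij => by
      simp only [midpointMatrix, Matrix.map_apply, if_neg hij]
      split_ifs <;> norm_num)
    (fun i => by
      have := midpointMatrix_mulVec B γ δ (fun _ => 1) i
      simp only [Matrix.mulVec, dotProduct, mul_one] at this
      rw [this]
      split_ifs <;> norm_num)
  have hcast : ((midpointMatrix B γ δ).map (Int.cast : ℤ → ℝ)).det =
      ((midpointMatrix B γ δ).det : ℝ) := (Int.cast_det _).symm
  rw [hcast] at h
  have hprod : ∏ b : B, ((midpointMatrix B γ δ).map (Int.cast : ℤ → ℝ)) b b ≤ 2 ^ B.card := by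
    have hb : ∀ b : B, 0 ≤ ((midpointMatrix B γ δ).map (Int.cast : ℤ → ℝ)) b b ∧
        ((midpointMatrix B γ δ).map (Int.cast : ℤ → ℝ)) b b ≤ 2 := fun b => by
      simp only [midpointMatrix, Matrix.map_apply]
      split_ifs <;> norm_num
    calc _ ≤ ∏ _b : B, (2 : ℝ) := Finset.prod_le_prod (fun b _ => (hb b).1) fun b _ => (hb b).2
      _ = 2 ^ B.card := by simp
  exact ⟨by exact_mod_cast h.1, by exact_mod_cast h.2.trans hprod⟩

/-- Cramer's rule: a solution of the midpoint system with integral values off `B` has integral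
values on `B` after multiplication by the determinant. -/
theorem exists_int_det_mul_eq (v : X → ℝ) (hv : ∀ b ∈ B, 2 * v b = v (γ b) + v (δ b))
    (hγ : ∀ b ∈ B, γ b ∉ B → ∃ k : ℤ, v (γ b) = k)
    (hδ : ∀ b ∈ B, δ b ∉ B → ∃ k : ℤ, v (δ b) = k) (b : X) (hb : b ∈ B) :
    ∃ k : ℤ, ((midpointMatrix B γ δ).det : ℝ) * v b = k := by
  set P := (midpointMatrix B γ δ).map (Int.cast : ℤ → ℝ) with hP
  have hr : ∀ c : B, ∃ k : ℤ, P.mulVec (fun c => v c) c = k := fun c => by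
    rw [hP, midpointMatrix_mulVec, hv c c.2]
    split_ifs with h1 h2 h2
    · exact ⟨0, by push_cast; ring⟩
    · obtain ⟨k, hk⟩ := hδ c c.2 h2
      exact ⟨k, by rw [hk]; ring⟩
    · obtain ⟨k, hk⟩ := hγ c c.2 h1
      exact ⟨k, by rw [hk]; ring⟩
    · obtain ⟨k, hk⟩ := hγ c c.2 h1
      obtain ⟨l, hl⟩ := hδ c c.2 h2
      exact ⟨k + l, by rw [hk, hl]; push_cast; ring⟩
  choose r hr using hr
  refine ⟨(midpointMatrix B γ δ).adjugate.mulVec r ⟨b, hb⟩, ?_⟩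
  have h1 : P.adjugate.mulVec (P.mulVec fun c => v c) = P.det • fun c : B => v c := by
    rw [Matrix.mulVec_mulVec, Matrix.adjugate_mul, Matrix.smul_mulVec, Matrix.one_mulVec]
  have h2 : P.adjugate = (midpointMatrix B γ δ).adjugate.map (Int.cast : ℤ → ℝ) :=
    ((Int.castRingHom ℝ).map_adjugate _).symm
  have h3 : P.det = ((midpointMatrix B γ δ).det : ℝ) := (Int.cast_det _).symm
  have h4 := congrFun h1 ⟨b, hb⟩
  rw [funext hr, h2, h3] at h4
  simp only [Pi.smul_apply, smul_eq_mul] at h4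
  rw [← h4]
  simp [Matrix.mulVec, dotProduct]

end midpointMatrix

theorem det_midpointMatrix_ne_zero {d : ℕ} (B : Finset (Fin d → ℝ))
    (γ δ : (Fin d → ℝ) → (Fin d → ℝ)) (hne : ∀ b ∈ B, γ b ≠ δ b)
    (hmid : ∀ b ∈ B, (2 : ℝ) • b = γ b + δ b) : (midpointMatrix B γ δ).det ≠ 0 := by
  intro hdet
  have hdet' : ((midpointMatrix B γ δ).map (Int.cast : ℤ → ℝ)).det = 0 :=
    (Int.cast_det _).symm.trans (by rw [hdet, Int.cast_zero])
  obtain ⟨v, hv0, hv⟩ := Matrix.exists_mulVec_eq_zero_iff.2 hdet'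
  apply hv0
  let w : (Fin d → ℝ) → ℝ := fun x => if h : x ∈ B then v ⟨x, h⟩ else 0
  have hwv : (fun c : B => w c) = v := by
    ext c
    simp [w]
  have hw0 : ∀ x, x ∉ B → w x = 0 := fun x hx => dif_neg hx
  have hw : ∀ b ∈ B, 2 * w b = w (γ b) + w (δ b) := fun b hb => by
    have h := midpointMatrix_mulVec B γ δ w ⟨b, hb⟩
    have hite : ∀ x, (if x ∈ B then w x else 0) = w x := fun x =>
      ite_eq_left_iff.2 fun hx => (hw0 x hx).symm
    rw [hwv, hv, hite, hite] at h
    simp only [Pi.zero_apply] at h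
    linarith
  have hle := nonpos_of_midpoint_mean B γ δ hne hmid w hw0 hw
  have hge := nonpos_of_midpoint_mean B γ δ hne hmid (fun x => -w x)
    (fun x hx => by simp [hw0 x hx]) (fun b hb => by linarith [hw b hb])
  rw [← hwv]
  ext c
  exact le_antisymm (hle c) (neg_nonpos.1 (hge c))

/-- Every `(𝒜, β)`-mediated set has cardinality at least `⌈log₂ ŝ⌉`. -/
theorem mediated_card_ge_clog {m : ℕ} (hm : 2 ≤ m)
    (α : Fin m → (Fin (m - 1) → ℝ)) (hα : AffineIndependent ℝ α)
    (s : Fin m → ℕ) (hs : ∀ i, 0 < s i) (hgcd : Finset.univ.gcd s = 1)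
    (β : Fin (m - 1) → ℝ)
    (hβ : β = ((∑ i, s i : ℕ) : ℝ)⁻¹ • ∑ i, (s i : ℝ) • α i)
    (B : Finset (Fin (m - 1) → ℝ))
    (hmed : IsMediatedSet (Set.range α) B) (hβB : β ∈ B) :
    Nat.clog 2 (∑ i, s i) ≤ B.card := by
  have hspos : 0 < ∑ i, s i :=
    Finset.sum_pos (fun i _ => hs i) ⟨⟨0, by omega⟩, Finset.mem_univ _⟩
  have hsne : ((∑ i, s i : ℕ) : ℝ) ≠ 0 := by exact_mod_cast hspos.ne'
  have htop : affineSpan ℝ (Set.range α) = ⊤ := by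
    rw [hα.affineSpan_eq_top_iff_card_eq_finrank_add_one]
    simp only [Fintype.card_fin, Module.finrank_fintype_fun_eq_card]
    omega
  let a : AffineBasis (Fin m) ℝ (Fin (m - 1) → ℝ) := ⟨α, hα, htop⟩
  have hmed' : ∀ b, ∃ γ δ : Fin (m - 1) → ℝ, b ∈ B → γ ∈ Set.range α ∪ ↑B ∧
      δ ∈ Set.range α ∪ ↑B ∧ γ ≠ δ ∧ (2 : ℝ) • b = γ + δ := fun b => by
    by_cases hb : b ∈ B
    · obtain ⟨γ, hγ, δ, hδ, h⟩ := hmed b hb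
      exact ⟨γ, δ, fun _ => ⟨hγ, hδ, h⟩⟩
    · exact ⟨0, 0, fun h => absurd h hb⟩
  choose γ δ hγδ using hmed'
  have hmid : ∀ b ∈ B, (2 : ℝ) • b = γ b + δ b := fun b hb => (hγδ b hb).2.2.2
  have hne := det_midpointMatrix_ne_zero B γ δ (fun b hb => (hγδ b hb).2.2.1) hmid
  obtain ⟨hnonneg, hle⟩ := det_midpointMatrix_nonneg_and_le B γ δ
  set D := (midpointMatrix B γ δ).det with hD
  have hcoord : ∀ i, ∀ x ∈ Set.range α ∪ ↑B, x ∉ B → ∃ k : ℤ, a.coord i x = k := by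
    rintro i x (⟨j, rfl⟩ | hx) hxB
    · refine ⟨if i = j then 1 else 0, ?_⟩
      have := a.coord_apply i j
      push_cast
      exact this
    · exact absurd hx hxB
  have hβcoord : ∀ i, a.coord i β = (s i : ℝ) / (∑ i, s i : ℕ) := fun i => by
    have hw : ∑ j, (s j : ℝ) / (∑ i, s i : ℕ) = 1 := by
      rw [← Finset.sum_div, ← Nat.cast_sum, div_self hsne]
    have hcomb : β = Finset.univ.affineCombination ℝ a fun j => (s j : ℝ) / (∑ i, s i : ℕ) := by
      rw [Finset.affineCombination_eq_linear_combination _ _ _ hw, hβ, Finset.smul_sum]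
      refine Finset.sum_congr rfl fun j _ => ?_
      rw [smul_smul, div_eq_inv_mul]
      rfl
    rw [hcomb, a.coord_apply_combination_of_mem (Finset.mem_univ i) hw]
  have hdvd : ∀ i, ∑ i, s i ∣ D.natAbs * s i := fun i => by
    have hmean : ∀ b ∈ B, 2 * a.coord i b = a.coord i (γ b) + a.coord i (δ b) := fun b hb => by
      have hb2 : b = midpoint ℝ (γ b) (δ b) := by
        rw [midpoint_eq_smul_add, ← hmid b hb, smul_smul]
        simp
      have h := (a.coord i).map_midpoint (γ b) (δ b)
      rw [← hb2, midpoint_eq_smul_add] at h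
      rw [h]
      simp
    obtain ⟨k, hk⟩ := exists_int_det_mul_eq B γ δ (a.coord i) hmean
      (fun b hb => hcoord i _ (hγδ b hb).1) (fun b hb => hcoord i _ (hγδ b hb).2.1) β hβB
    rw [← hD, hβcoord, ← mul_div_assoc, div_eq_iff hsne] at hk
    have hk' : D * (s i : ℤ) = k * ((∑ i, s i : ℕ) : ℤ) := by exact_mod_cast hk
    have hint : ((∑ i, s i : ℕ) : ℤ) ∣ D * (s i : ℤ) := ⟨k, by rw [hk', mul_comm]⟩
    have h := Int.natAbs_dvd_natAbs.2 hint
    rwa [Int.natAbs_mul, Int.natAbs_natCast, Int.natAbs_natCast] at h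
  have hdvdD : ∑ i, s i ∣ D.natAbs := by
    have h := Finset.dvd_gcd fun i (_ : i ∈ Finset.univ) => hdvd i
    rwa [Finset.gcd_mul_left, hgcd, mul_one, normalize_eq] at h
  apply Nat.clog_le_of_le_pow
  refine (Nat.le_of_dvd (Int.natAbs_pos.2 hne) hdvdD).trans ?_
  zify
  rwa [abs_of_nonneg hnonneg]
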